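/- arXiv:1709.06606 — 2 statements merged into one kernel-verified Lean document; each statement's English description precedes it below -/
import Mathlib

section
/- Let C_E, C_Y ∈ ℝ^{n×n} be symmetric positive definite and fix 1 ≤ r ≤ n. Let λ₁ ≥ λ₂ ≥ … ≥ λₙ > 0 be the eigenvalues (with multiplicity) of C_E^{-1/2} C_Y C_E^{-1/2} (equivalently, of the generalized eigenvalue problem C_Y v = λ C_E v). Then the supremum over all full-column-rank V ∈ ℝ^{n×r} of ½ log det( (Vᵀ C_Y V)(Vᵀ C_E V)⁻¹ ) equals ½ ∑_{i=1}^r log λᵢ, and it is attained. -/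
open Matrix

/-- The determinant of `1 + X` is at least one when `X` is positive semidefinite. -/
lemma Matrix.PosSemidef.one_le_det_one_add {m : Type*} [Fintype m] [DecidableEq m]
    {X : Matrix m m ℝ} (hX : X.PosSemidef) : 1 ≤ (1 + X).det := by
  have h : (1 + X).det = ∏ i, (1 + hX.1.eigenvalues i) := by
    have h1 := Matrix.eval_charpoly X (-1)
    have h2 : scalar m (-1 : ℝ) - X = -(1 + X) := by
      rw [map_neg, map_one]; abel
    rw [h2, det_neg, hX.1.charpoly_eq, Polynomial.eval_prod] at h1
    have h3 : ∀ i, Polynomial.eval (-1)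
        (Polynomial.X - Polynomial.C ((hX.1.eigenvalues i : ℝ) : ℝ))
        = (-1) * (1 + hX.1.eigenvalues i) := fun i => by simp; ring
    simp only [RCLike.ofReal_real_eq_id, id, h3, Finset.prod_mul_distrib, Finset.prod_const,
      Finset.card_univ] at h1
    exact (mul_left_cancel₀ (pow_ne_zero _ (by norm_num)) h1).symm
  rw [h]
  calc (1 : ℝ) = ∏ _i : m, 1 := Finset.prod_const_one.symm
    _ ≤ _ := Finset.prod_le_prod (fun _ _ => zero_le_one) fun i _ => by
      linarith [hX.eigenvalues_nonneg i]

/-- The determinant is monotone for the Loewner order above a positive definite matrix. -/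
lemma Matrix.PosDef.det_le_det_of_posSemidef_sub {m : Type*} [Fintype m] [DecidableEq m]
    {A B : Matrix m m ℝ} (hA : A.PosDef) (hAB : (B - A).PosSemidef) : A.det ≤ B.det := by
  obtain ⟨K, hK⟩ : ∃ K : Matrix m m ℝ, B - A = Kᴴ * K := by
    open scoped MatrixOrder in
    exact CStarAlgebra.nonneg_iff_eq_star_mul_self.mp hAB.nonneg
  have hB : B = A + Kᴴ * K := by rw [← hK]; abel
  rw [hB, det_add_mul _ _ hA.det_pos.ne'.isUnit]
  have := (hA.inv.posSemidef.mul_mul_conjTranspose_same K).one_le_det_one_add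
  nlinarith [hA.det_pos]

/-- A matrix with full column rank acts injectively. -/
lemma Matrix.mulVec_injective_of_rank_eq {n r : ℕ} {V : Matrix (Fin n) (Fin r) ℝ}
    (hV : V.rank = r) : Function.Injective V.mulVec := by
  rw [mulVec_injective_iff, linearIndependent_iff_card_eq_finrank_span, Fintype.card_fin,
    Set.finrank, ← rank_eq_finrank_span_cols, hV]

/-- The orthogonal projection onto the column space of `W` is at most the identity. -/
lemma Matrix.posSemidef_one_sub_projection {m k : Type*} [Fintype m] [Fintype k] [DecidableEq m]
    [DecidableEq k] {W : Matrix m k ℝ} (hW : (Wᴴ * W).PosDef) :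
    (1 - W * (Wᴴ * W)⁻¹ * Wᴴ).PosSemidef := by
  set S := W * (Wᴴ * W)⁻¹ * Wᴴ with hS
  have hSH : Sᴴ = S := isHermitian_mul_mul_conjTranspose W hW.inv.1
  have hSS : S * S = S := by
    calc S * S = W * ((Wᴴ * W)⁻¹ * (Wᴴ * W)) * (Wᴴ * W)⁻¹ * Wᴴ := by
          simp only [hS, Matrix.mul_assoc]
      _ = S := by
        rw [nonsing_inv_mul _ hW.det_pos.ne'.isUnit, Matrix.mul_one]
  have h : 1 - S = (1 - S)ᴴ * (1 - S) := by
    rw [conjTranspose_sub, conjTranspose_one, hSH]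
    simp [Matrix.sub_mul, Matrix.mul_sub, hSS]
  rw [h]
  exact posSemidef_conjTranspose_mul_self _

/-- Compressing a positive diagonal matrix with decreasing entries to an `r`-dimensional
subspace yields at most the product of the `r` largest entries as determinant ratio. -/
lemma Matrix.det_compression_diagonal_le {n r : ℕ} (hr : 1 ≤ r) (hrn : r ≤ n) {d : Fin n → ℝ}
    (hd : Antitone d) (hpos : ∀ i, 0 < d i) {W : Matrix (Fin n) (Fin r) ℝ}
    (hW : Function.Injective W.mulVec) :
    (Wᴴ * diagonal d * W).det ≤ (Wᴴ * W).det * ∏ i : Fin r, d (Fin.castLE hrn i) := by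
  have hG : (Wᴴ * W).PosDef := PosDef.conjTranspose_mul_self W hW
  let l : Fin n := Fin.castLE hrn ⟨r - 1, by omega⟩
  have hμ : 0 < d l := hpos l
  have hle : ∀ i : Fin r, d l ≤ d (Fin.castLE hrn i) := fun i => hd (by
    rw [Fin.le_def]; simp [l]; omega)
  -- `Qᴴ * Q` is the excess of the `r` largest entries over the `r`-th one.
  let c : Fin r → ℝ := fun i => √(d (Fin.castLE hrn i) / d l - 1)
  have hc : ∀ i, 1 + c i * c i = d (Fin.castLE hrn i) / d l := fun i => by
    rw [Real.mul_self_sqrt (sub_nonneg.2 ((one_le_div hμ).2 (hle i)))]; ring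
  let Q : Matrix (Fin r) (Fin n) ℝ :=
    diagonal c * (1 : Matrix (Fin n) (Fin n) ℝ).submatrix (Fin.castLE hrn) id
  have hQ : ∀ i j, Q i j = if Fin.castLE hrn i = j then c i else 0 := fun i j => by
    simp [Q, diagonal_mul, one_apply]
  have hQQ : 1 + Q * Qᴴ = diagonal fun i => d (Fin.castLE hrn i) / d l := by
    ext i j
    rw [add_apply, mul_apply]
    simp only [hQ, conjTranspose_apply, star_trivial]
    by_cases hij : i = j
    · subst hij; simp [hc]
    · simp [hij]
  have hdom : (d l • (1 + Qᴴ * Q) - diagonal d).PosSemidef := by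
    have : d l • (1 + Qᴴ * Q) - diagonal d
        = diagonal fun j : Fin n => if (j : ℕ) < r then 0 else d l - d j := by
      ext j k
      rw [sub_apply, smul_apply, add_apply, mul_apply]
      simp only [hQ, conjTranspose_apply, star_trivial, smul_eq_mul]
      by_cases hjk : j = k
      · subst hjk
        by_cases hj : (j : ℕ) < r
        · obtain ⟨i, rfl⟩ : ∃ i : Fin r, Fin.castLE hrn i = j := ⟨⟨j, hj⟩, by ext; simp⟩
          have : ∀ x, (Fin.castLE hrn x = Fin.castLE hrn i) = (x = i) := fun x =>
            propext (Fin.castLE_injective hrn).eq_iff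
          simp only [this]
          simp [hc]
          field_simp
          ring
        · have : ∀ x : Fin r, ¬ Fin.castLE hrn x = j := fun x h => hj (by simp [← h])
          simp [this, hj]
      · have : ∀ x : Fin r, (if Fin.castLE hrn x = j then c x else 0)
            * (if Fin.castLE hrn x = k then c x else 0) = 0 := fun x => by
          by_cases h : Fin.castLE hrn x = j
          · simp [h, hjk]
          · simp [h]
        simp [this, hjk]
    rw [this]
    refine PosSemidef.diagonal fun j => ?_
    by_cases hj : (j : ℕ) < r
    · simp [hj]
    · simp only [hj, if_false, Pi.zero_apply, sub_nonneg]
      exact hd (by rw [Fin.le_def]; simp [l]; omega)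
  have hA : (Wᴴ * diagonal d * W).PosDef := (PosDef.diagonal hpos).conjTranspose_mul_mul_same hW
  have h1 : (Wᴴ * diagonal d * W).det ≤ (d l • (Wᴴ * W + (Q * W)ᴴ * (Q * W))).det := by
    refine hA.det_le_det_of_posSemidef_sub ?_
    have := hdom.conjTranspose_mul_mul_same W
    convert this using 1
    simp only [conjTranspose_mul, Matrix.mul_sub, Matrix.sub_mul, Matrix.mul_smul,
      Matrix.smul_mul, Matrix.mul_add, Matrix.add_mul, Matrix.mul_one, Matrix.mul_assoc]
  have h2 : (1 + Q * W * (Wᴴ * W)⁻¹ * (Q * W)ᴴ).det ≤ (1 + Q * Qᴴ).det := by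
    refine PosDef.det_le_det_of_posSemidef_sub (PosDef.one.add_posSemidef
      (hG.inv.posSemidef.mul_mul_conjTranspose_same _)) ?_
    have := (posSemidef_one_sub_projection hG).mul_mul_conjTranspose_same Q
    convert this using 1
    simp only [conjTranspose_mul, Matrix.mul_sub, Matrix.sub_mul, Matrix.mul_one,
      Matrix.mul_assoc]
    abel
  refine h1.trans ?_
  rw [det_smul, det_add_mul _ _ hG.det_pos.ne'.isUnit, Fintype.card_fin]
  calc d l ^ r * ((Wᴴ * W).det * (1 + Q * W * (Wᴴ * W)⁻¹ * (Q * W)ᴴ).det)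
      ≤ d l ^ r * ((Wᴴ * W).det * (1 + Q * Qᴴ).det) := by
        have := hG.det_pos
        gcongr
    _ = _ := by
        rw [hQQ, det_diagonal, Finset.prod_div_distrib]
        simp only [Finset.prod_const, Finset.card_univ, Fintype.card_fin]
        field_simp

/-- Theorem 3.6 (optimal value): let `λ₁ ≥ … ≥ λₙ` be the eigenvalues of the
generalized eigenvalue problem `C_Y v = λ C_E v` (equivalently, of
`C_E^{-1/2} C_Y C_E^{-1/2}`), encoded by a `C_E`-orthonormal eigenbasis `P`
with `Pᵀ C_E P = I` and `C_Y P = C_E P diag(λ)`.  Then the supremum over all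
full-column-rank `V ∈ ℝ^{n×r}` of `½ log det((Vᵀ C_Y V)(Vᵀ C_E V)⁻¹)` equals
`½ ∑_{i=1}^r log λᵢ`, and it is attained. -/
theorem stmt_12 {n r : ℕ} (hr : 1 ≤ r) (hrn : r ≤ n)
    (CE CY : Matrix (Fin n) (Fin n) ℝ) (hCE : CE.PosDef) (hCY : CY.PosDef)
    (lam : Fin n → ℝ) (hlam : Antitone lam)
    (P : Matrix (Fin n) (Fin n) ℝ) (hP : Pᵀ * CE * P = 1)
    (hgen : CY * P = CE * P * Matrix.diagonal lam) :
    IsGreatest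
      {x : ℝ | ∃ V : Matrix (Fin n) (Fin r) ℝ, V.rank = r ∧
        x = (1 / 2) * Real.log ((Vᵀ * CY * V) * (Vᵀ * CE * V)⁻¹).det}
      ((1 / 2) * ∑ i : Fin r, Real.log (lam (Fin.castLE hrn i))) := by
  have hdetP : IsUnit P.det := by
    have := congrArg det hP
    rw [det_mul, det_one] at this
    exact IsUnit.of_mul_eq_one_right _ this
  have hPY : Pᵀ * CY * P = diagonal lam := by
    rw [Matrix.mul_assoc, hgen, ← Matrix.mul_assoc, ← Matrix.mul_assoc, hP, Matrix.one_mul]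
  have hPinj : Function.Injective P.mulVec :=
    mulVec_injective_iff_isUnit.2 ((isUnit_iff_isUnit_det P).2 hdetP)
  have hpos : ∀ i, 0 < lam i := by
    have := hCY.conjTranspose_mul_mul_same hPinj
    rw [conjTranspose_eq_transpose_of_trivial, hPY] at this
    exact posDef_diagonal_iff.1 this
  -- The change of variables `V = P * W` diagonalizes both quadratic forms.
  have hE : ∀ W : Matrix (Fin n) (Fin r) ℝ, (P * W)ᵀ * CE * (P * W) = Wᵀ * W := fun W => by
    calc (P * W)ᵀ * CE * (P * W) = Wᵀ * (Pᵀ * CE * P) * W := by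
          simp only [transpose_mul, Matrix.mul_assoc]
      _ = _ := by rw [hP, Matrix.mul_one]
  have hY : ∀ W : Matrix (Fin n) (Fin r) ℝ,
      (P * W)ᵀ * CY * (P * W) = Wᵀ * diagonal lam * W := fun W => by
    rw [← hPY]
    simp only [transpose_mul, Matrix.mul_assoc]
  have hsum : ∑ i : Fin r, Real.log (lam (Fin.castLE hrn i))
      = Real.log (∏ i : Fin r, lam (Fin.castLE hrn i)) :=
    (Real.log_prod fun i _ => (hpos _).ne').symm
  rw [hsum]
  let J : Matrix (Fin n) (Fin r) ℝ :=
    (1 : Matrix (Fin n) (Fin n) ℝ).submatrix id (Fin.castLE hrn)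
  have hJ : ∀ M : Matrix (Fin n) (Fin n) ℝ,
      Jᵀ * M * J = M.submatrix (Fin.castLE hrn) (Fin.castLE hrn) := fun M => by
    calc Jᵀ * M * J = (1 * M * 1 : Matrix (Fin n) (Fin n) ℝ).submatrix
          (Fin.castLE hrn) (Fin.castLE hrn) := by
          rw [submatrix_mul _ _ _ id _ Function.bijective_id,
            submatrix_mul _ _ _ id _ Function.bijective_id, submatrix_id_id,
            transpose_submatrix, transpose_one]
      _ = _ := by rw [Matrix.one_mul, Matrix.mul_one]
  have hJJ : Jᵀ * J = 1 := by
    rw [← Matrix.mul_one Jᵀ, hJ, submatrix_one _ (Fin.castLE_injective hrn)]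
  refine ⟨⟨P * J, ?_, ?_⟩, ?_⟩
  · rw [rank_mul_eq_right_of_isUnit_det _ _ hdetP, ← rank_transpose_mul_self, hJJ, rank_one,
      Fintype.card_fin]
  · rw [hE, hY, hJJ, hJ, inv_one, Matrix.mul_one,
      submatrix_diagonal _ _ (Fin.castLE_injective hrn), det_diagonal]
    rfl
  · rintro x ⟨V, hV, rfl⟩
    obtain ⟨W, rfl⟩ : ∃ W, V = P * W := ⟨P⁻¹ * V, by rw [mul_nonsing_inv_cancel_left _ _ hdetP]⟩
    rw [rank_mul_eq_right_of_isUnit_det _ _ hdetP] at hV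
    have hW := mulVec_injective_of_rank_eq hV
    have hG := PosDef.conjTranspose_mul_self W hW
    have hA := (PosDef.diagonal hpos).conjTranspose_mul_mul_same hW
    have hle := det_compression_diagonal_le hr hrn hlam hpos hW
    rw [conjTranspose_eq_transpose_of_trivial] at hG hA hle
    rw [hE, hY, det_mul, det_nonsing_inv, Ring.inverse_eq_inv', ← div_eq_mul_inv]
    gcongr
    · exact div_pos hA.det_pos hG.det_pos
    · rwa [div_le_iff₀' hG.det_pos]
end

section
/- Let C_X ∈ ℝ^{q×q} and C_E ∈ ℝ^{n×n} be symmetric positive definite, B ∈ ℝ^{n×q} with rank B = m, C_Y = B C_X Bᵀ + C_E, and suppose m ≤ r ≤ n. Then the supremum over all full-column-rank V ∈ ℝ^{n×r} of log det( (Vᵀ C_Y V)(Vᵀ C_E V)⁻¹ ) equals log det( C_Y C_E⁻¹ ); that is, the reduced model with r ≥ rank B projected observations retains the full mutual information: I(W, X) = I(Y, X). In particular this holds whenever r ≥ q. -/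
open Matrix

open scoped MatrixOrder Matrix.Norms.L2Operator in
theorem Matrix.PosSemidef.exists_eq_transpose_mul_self {ι : Type*} [Fintype ι] [DecidableEq ι]
    {T : Matrix ι ι ℝ} (hT : T.PosSemidef) : ∃ K : Matrix ι ι ℝ, T = Kᵀ * K := by
  obtain ⟨K, hK⟩ := CStarAlgebra.nonneg_iff_eq_star_mul_self.mp hT.nonneg
  exact ⟨K, by rwa [star_eq_conjTranspose, conjTranspose_eq_transpose_of_trivial] at hK⟩

theorem Matrix.PosSemidef.one_le_det_one_add_s17 {ι : Type*} [Fintype ι] [DecidableEq ι]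
    {T : Matrix ι ι ℝ} (hT : T.PosSemidef) : 1 ≤ (1 + T).det := by
  have hU : star (hT.1.eigenvectorUnitary : Matrix ι ι ℝ) * hT.1.eigenvectorUnitary = 1 :=
    Unitary.coe_star_mul_self _
  rw [hT.1.spectral_theorem, Unitary.conjStarAlgAut_apply, Matrix.mul_assoc,
    det_one_add_mul_comm, Matrix.mul_assoc, hU, Matrix.mul_one, ← diagonal_one, diagonal_add,
    det_diagonal]
  rw [← Finset.prod_const_one (ι := ι) (s := Finset.univ)]
  refine Finset.prod_le_prod (fun _ _ => zero_le_one) fun i _ => ?_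
  simpa using hT.eigenvalues_nonneg i

theorem Matrix.PosDef.det_le_det_add {ι : Type*} [Fintype ι] [DecidableEq ι]
    {S T : Matrix ι ι ℝ} (hS : S.PosDef) (hT : T.PosSemidef) : S.det ≤ (S + T).det := by
  obtain ⟨K, rfl⟩ := hT.exists_eq_transpose_mul_self
  rw [det_add_mul _ _ hS.det_pos.ne'.isUnit]
  refine le_mul_of_one_le_right hS.det_pos.le (PosSemidef.one_le_det_one_add_s17 ?_)
  simpa [conjTranspose_eq_transpose_of_trivial] using
    hS.inv.posSemidef.mul_mul_conjTranspose_same K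

theorem Matrix.mulVec_injective_of_rank_eq_card {K ι κ : Type*} [Field K] [Fintype ι] [Fintype κ]
    {V : Matrix ι κ K} (hV : V.rank = Fintype.card κ) : Function.Injective V.mulVec := by
  have h : LinearIndependent K V.col := by
    rw [linearIndependent_iff_card_eq_finrank_span, Set.finrank, ← rank_eq_finrank_span_cols, hV]
  exact mulVec_injective_iff.mpr h

/-- A matrix of rank at most `r` factors through a matrix with `r` independent columns. -/
theorem Matrix.exists_rank_eq_mul_eq {K : Type*} [Field K] {n q r : ℕ} (hrn : r ≤ n)
    (A : Matrix (Fin n) (Fin q) K) (hA : A.rank ≤ r) :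
    ∃ (V : Matrix (Fin n) (Fin r) K) (Z : Matrix (Fin r) (Fin q) K), V.rank = r ∧ V * Z = A := by
  set W := Submodule.span K (Set.range A.col)
  have hWr : Module.finrank K W = A.rank := A.rank_eq_finrank_span_cols.symm
  have hquot := W.finrank_quotient_add_finrank
  rw [Module.finrank_fin_fun, hWr] at hquot
  let b := Module.finBasisOfFinrankEq K W hWr
  obtain ⟨f, hf⟩ := exists_linearIndependent_of_le_finrank
    (R := K) (M := (Fin n → K) ⧸ W) (n := r - A.rank) (by omega)
  choose g hg using fun i => W.mkQ_surjective (f i)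
  have hli : LinearIndependent K (Sum.elim (fun i => (b i : Fin n → K)) g) :=
    b.linearIndependent.sumElim_of_quotient g (by rwa [← funext hg] at hf)
  let e : Fin r ≃ Fin A.rank ⊕ Fin (r - A.rank) :=
    (finCongr (by omega)).trans finSumFinEquiv.symm
  let v : Fin r → Fin n → K := Sum.elim (fun i => (b i : Fin n → K)) g ∘ e
  have hv : LinearIndependent K v := hli.comp e e.injective
  have hmem (j : Fin q) : A.col j ∈ Submodule.span K (Set.range v) := by
    have hle : W ≤ Submodule.span K (Set.range v) := by
      have hb := congrArg (Submodule.map W.subtype) b.span_eq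
      rw [Submodule.map_span, Submodule.map_top, Submodule.range_subtype] at hb
      rw [← hb]
      refine Submodule.span_mono ?_
      rintro _ ⟨_, ⟨i, rfl⟩, rfl⟩
      exact ⟨e.symm (Sum.inl i), by simp [v]⟩
    exact hle (Submodule.subset_span ⟨j, rfl⟩)
  choose c hc using fun j => (Submodule.mem_span_range_iff_exists_fun K).mp (hmem j)
  refine ⟨(of v)ᵀ, (of c)ᵀ, ?_, ?_⟩
  · rw [rank_transpose, LinearIndependent.rank_matrix (M := of v) hv, Fintype.card_fin]
  · ext i j
    simpa [mul_apply, mul_comm] using congrFun (hc j) i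

theorem Matrix.det_mul_transpose_add_mul_inv {R ι κ : Type*} [CommRing R] [Fintype ι]
    [DecidableEq ι] [Fintype κ] [DecidableEq κ] {D : Matrix ι ι R} (hD : IsUnit D.det)
    (W : Matrix ι κ R) : ((W * Wᵀ + D) * D⁻¹).det = (1 + Wᵀ * D⁻¹ * W).det := by
  rw [Matrix.add_mul, mul_nonsing_inv _ hD, add_comm, Matrix.mul_assoc, det_one_add_mul_comm]

/-- The inverse of the compression of `C` along `V`, mapped back by `V`, is dominated by `C⁻¹`. -/
theorem Matrix.PosDef.posSemidef_inv_sub_compression {ι κ : Type*} [Fintype ι] [DecidableEq ι]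
    [Fintype κ] [DecidableEq κ] {C : Matrix ι ι ℝ} (hC : C.PosDef) {V : Matrix ι κ ℝ}
    (hV : (Vᵀ * C * V).PosDef) : (C⁻¹ - V * (Vᵀ * C * V)⁻¹ * Vᵀ).PosSemidef := by
  set M := (Vᵀ * C * V)⁻¹
  have hCs : Cᵀ = C := hC.1
  have hMs : Mᵀ = M := hV.inv.1
  have hCu : IsUnit C.det := hC.det_pos.ne'.isUnit
  have hMV : M * (Vᵀ * (C * (V * (M * Vᵀ)))) = M * Vᵀ := by
    have h : M * (Vᵀ * C * V) = 1 := nonsing_inv_mul _ hV.det_pos.ne'.isUnit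
    calc M * (Vᵀ * (C * (V * (M * Vᵀ)))) = M * (Vᵀ * C * V) * (M * Vᵀ) := by
          simp only [Matrix.mul_assoc]
      _ = M * Vᵀ := by rw [h, Matrix.one_mul]
  have key : (C⁻¹ - V * M * Vᵀ)ᴴ * C * (C⁻¹ - V * M * Vᵀ) = C⁻¹ - V * M * Vᵀ := by
    rw [conjTranspose_eq_transpose_of_trivial, transpose_sub, transpose_mul, transpose_mul,
      transpose_transpose, transpose_nonsing_inv, hCs, hMs]
    simp only [Matrix.sub_mul, Matrix.mul_sub, Matrix.mul_assoc, hMV, mul_nonsing_inv _ hCu,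
      Matrix.mul_one, nonsing_inv_mul_cancel_left _ _ hCu]
    abel
  rw [← key]
  exact hC.posSemidef.conjTranspose_mul_mul_same _

/-- Corollary 3.8: if `rank B = m ≤ r`, the supremum over all full-column-rank
`V ∈ ℝ^{n×r}` of `log det((Vᵀ C_Y V)(Vᵀ C_E V)⁻¹)` equals
`log det(C_Y C_E⁻¹)` and it is attained: the reduced model with `r ≥ rank B`
projected observations retains the full mutual information `I(W,X) = I(Y,X)`.
In particular this holds whenever `r ≥ q`. -/
theorem stmt_17 {q n r m : ℕ} (hr : 1 ≤ r) (hrn : r ≤ n)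
    (CX : Matrix (Fin q) (Fin q) ℝ) (CE : Matrix (Fin n) (Fin n) ℝ)
    (hCX : CX.PosDef) (hCE : CE.PosDef)
    (B : Matrix (Fin n) (Fin q) ℝ) (hm : B.rank = m) (hmr : m ≤ r)
    (CY : Matrix (Fin n) (Fin n) ℝ) (hCY : CY = B * CX * Bᵀ + CE) :
    IsGreatest
      {x : ℝ | ∃ V : Matrix (Fin n) (Fin r) ℝ, V.rank = r ∧
        x = Real.log ((Vᵀ * CY * V) * (Vᵀ * CE * V)⁻¹).det}
      (Real.log (CY * CE⁻¹).det) := by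
  obtain ⟨K, rfl⟩ := hCX.posSemidef.exists_eq_transpose_mul_self
  set A := B * Kᵀ with hA
  have hCYA : CY = A * Aᵀ + CE := by
    rw [hCY, hA, transpose_mul, transpose_transpose]
    simp only [Matrix.mul_assoc]
  have hCEu : IsUnit CE.det := hCE.det_pos.ne'.isUnit
  have hY : (CY * CE⁻¹).det = (1 + Aᵀ * CE⁻¹ * A).det := by
    rw [hCYA, det_mul_transpose_add_mul_inv hCEu]
  have hVE {V : Matrix (Fin n) (Fin r) ℝ} (hV : V.rank = r) : (Vᵀ * CE * V).PosDef := by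
    simpa [conjTranspose_eq_transpose_of_trivial] using
      hCE.conjTranspose_mul_mul_same (mulVec_injective_of_rank_eq_card (V := V) (by simpa using hV))
  have hW {V : Matrix (Fin n) (Fin r) ℝ} (hV : V.rank = r) :
      ((Vᵀ * CY * V) * (Vᵀ * CE * V)⁻¹).det =
        (1 + Aᵀ * (V * (Vᵀ * CE * V)⁻¹ * Vᵀ) * A).det := by
    have h := det_mul_transpose_add_mul_inv (hVE hV).det_pos.ne'.isUnit (Vᵀ * A)
    rw [transpose_mul, transpose_transpose] at h
    simpa only [hCYA, Matrix.mul_add, Matrix.add_mul, Matrix.mul_assoc] using h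
  constructor
  · obtain ⟨V, Z, hV, hVZ⟩ := exists_rank_eq_mul_eq hrn (CE⁻¹ * A)
      ((rank_mul_le_right _ _).trans ((rank_mul_le_left _ _).trans (hm.trans_le hmr)))
    refine ⟨V, hV, ?_⟩
    have hAZ : A = CE * (V * Z) := by rw [hVZ, mul_nonsing_inv_cancel_left _ _ hCEu]
    have hproj : V * (Vᵀ * CE * V)⁻¹ * Vᵀ * A = CE⁻¹ * A := by
      have h := nonsing_inv_mul_cancel_left (Vᵀ * CE * V) Z (hVE hV).det_pos.ne'.isUnit
      calc V * (Vᵀ * CE * V)⁻¹ * Vᵀ * A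
          = V * ((Vᵀ * CE * V)⁻¹ * (Vᵀ * CE * V * Z)) := by
            rw [hAZ]
            simp only [Matrix.mul_assoc]
        _ = CE⁻¹ * A := by rw [h, hVZ]
    rw [hY, hW hV, Matrix.mul_assoc Aᵀ, Matrix.mul_assoc Aᵀ, hproj]
  · rintro _ ⟨V, hV, rfl⟩
    have hS : (1 + Aᵀ * (V * (Vᵀ * CE * V)⁻¹ * Vᵀ) * A).PosDef := by
      refine PosDef.one.add_posSemidef ?_
      have h := (hVE hV).inv.posSemidef.conjTranspose_mul_mul_same (Vᵀ * A)
      simpa only [conjTranspose_eq_transpose_of_trivial, transpose_mul, transpose_transpose,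
        Matrix.mul_assoc] using h
    have hT := (hCE.posSemidef_inv_sub_compression (hVE hV)).conjTranspose_mul_mul_same A
    rw [conjTranspose_eq_transpose_of_trivial] at hT
    rw [hY, hW hV]
    refine Real.log_le_log hS.det_pos ((hS.det_le_det_add hT).trans_eq ?_)
    rw [Matrix.mul_sub, Matrix.sub_mul, add_assoc, add_sub_cancel]
end
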